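/- Second derivative of the log-Euclidean exponent function Ẽ_h at s = 0: Let W be a classical-quantum channel with finite input alphabet X whose outputs W_x are positive definite density operators on ℂ^d, let σ be a positive definite density operator on ℂ^d, and let P be a probability distribution on X. Then the function s ↦ Ẽ_h(s,P,σ) := −(1+s)·Σ_{x:P(x)>0} P(x)·log Tr[exp((log W_x + s·log σ)/(1+s))] is twice differentiable from the right at s = 0 with second derivative equal to −Σ_{x:P(x)>0} P(x)·Ṽ(W_x‖σ), where Ṽ(ρ‖σ) := ∫₀¹ Tr[ρ^{1−t}(log ρ − log σ)ρ^t(log ρ − log σ)] dt − D(ρ‖σ)². -/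

import Mathlib

open scoped BigOperators ComplexOrder
open Filter

noncomputable section

namespace MDQ

/-- Functional calculus for Hermitian matrices (junk value `0` otherwise). -/
noncomputable def matFun {d : ℕ} (f : ℝ → ℝ) (A : Matrix (Fin d) (Fin d) ℂ) :
    Matrix (Fin d) (Fin d) ℂ :=
  if hA : A.IsHermitian then hA.cfc f else 0

/-- Matrix logarithm on the support (`Real.log 0 = 0`). -/
noncomputable def mlog {d : ℕ} (A : Matrix (Fin d) (Fin d) ℂ) : Matrix (Fin d) (Fin d) ℂ :=
  matFun Real.log A

/-- Matrix real power, restricted to the support. -/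
noncomputable def mpow {d : ℕ} (A : Matrix (Fin d) (Fin d) ℂ) (p : ℝ) :
    Matrix (Fin d) (Fin d) ℂ :=
  matFun (fun t => if t = 0 then 0 else t ^ p) A

/-- Matrix exponential via functional calculus. -/
noncomputable def mexp {d : ℕ} (A : Matrix (Fin d) (Fin d) ℂ) : Matrix (Fin d) (Fin d) ℂ :=
  matFun Real.exp A

/-- Orthogonal projection onto the support of a Hermitian matrix. -/
noncomputable def suppProj {d : ℕ} (A : Matrix (Fin d) (Fin d) ℂ) : Matrix (Fin d) (Fin d) ℂ :=
  matFun (fun t => if t = 0 then 0 else 1) A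

/-- `A` is a density operator. -/
def IsDensity {d : ℕ} (A : Matrix (Fin d) (Fin d) ℂ) : Prop :=
  A.PosSemidef ∧ A.trace = 1

/-- Real part of the trace. -/
noncomputable def reTr {ι : Type} [Fintype ι] (A : Matrix ι ι ℂ) : ℝ :=
  A.trace.re

/-- supp ρ ⊆ supp σ, phrased via ranges of the associated linear maps. -/
def SuppLE {d : ℕ} (ρ σ : Matrix (Fin d) (Fin d) ℂ) : Prop :=
  LinearMap.range (Matrix.toLin' ρ) ≤ LinearMap.range (Matrix.toLin' σ)

/-- Quantum relative entropy `D(ρ‖σ)`. -/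
noncomputable def qD {d : ℕ} (ρ σ : Matrix (Fin d) (Fin d) ℂ) : ℝ :=
  reTr (ρ * (mlog ρ - mlog σ))

/-- Quantum relative entropy variance `V(ρ‖σ)`. -/
noncomputable def qV {d : ℕ} (ρ σ : Matrix (Fin d) (Fin d) ℂ) : ℝ :=
  reTr (ρ * (mlog ρ - mlog σ) ^ 2) - (qD ρ σ) ^ 2

/-- The variant relative entropy variance `Ṽ(ρ‖σ)`. -/
noncomputable def qVtilde {d : ℕ} (ρ σ : Matrix (Fin d) (Fin d) ℂ) : ℝ :=
  (∫ t in (0:ℝ)..1,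
    reTr (mpow ρ (1 - t) * (mlog ρ - mlog σ) * mpow ρ t * (mlog ρ - mlog σ))) - (qD ρ σ) ^ 2

/-- The quantum Rényi divergence of order zero, `D₀(ρ‖σ) = -log Tr[Π_ρ σ]`. -/
noncomputable def qD0 {d : ℕ} (ρ σ : Matrix (Fin d) (Fin d) ℂ) : ℝ :=
  - Real.log (reTr (suppProj ρ * σ))

/-- Tensor product of a finite family of `d × d` matrices. -/
noncomputable def tensorSeq {d n : ℕ} (A : Fin n → Matrix (Fin d) (Fin d) ℂ) :
    Matrix (Fin n → Fin d) (Fin n → Fin d) ℂ :=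
  Matrix.of fun i j => ∏ k, A k (i k) (j k)

/-- `n`-fold tensor power of a matrix. -/
noncomputable def tensorPow {d : ℕ} (A : Matrix (Fin d) (Fin d) ℂ) (n : ℕ) :
    Matrix (Fin n → Fin d) (Fin n → Fin d) ℂ :=
  tensorSeq (fun _ => A)

/-- Smallest type-I error with type-II error at most `μ`:  `α̂_μ(ρ‖σ)`. -/
noncomputable def hypoErr {ι : Type} [Fintype ι] [DecidableEq ι]
    (ρ σ : Matrix ι ι ℂ) (μ : ℝ) : ℝ :=
  sInf { a : ℝ | ∃ Q : Matrix ι ι ℂ, Q.PosSemidef ∧ (1 - Q).PosSemidef ∧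
    reTr (Q * σ) ≤ μ ∧ a = reTr ((1 - Q) * ρ) }

/-- `P` is a probability distribution on a finite alphabet. -/
def IsProbDist {X : Type} [Fintype X] (P : X → ℝ) : Prop :=
  (∀ x, 0 ≤ P x) ∧ ∑ x, P x = 1

/-- The average output state `PW`. -/
noncomputable def avgState {X : Type} [Fintype X] {d : ℕ}
    (P : X → ℝ) (W : X → Matrix (Fin d) (Fin d) ℂ) : Matrix (Fin d) (Fin d) ℂ :=
  ∑ x, (P x : ℂ) • W x

/-- Mutual information `I(P, W)`. -/
noncomputable def mutualInfo {X : Type} [Fintype X] {d : ℕ}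
    (P : X → ℝ) (W : X → Matrix (Fin d) (Fin d) ℂ) : ℝ :=
  ∑ x, P x * qD (W x) (avgState P W)

/-- Capacity `C_W`. -/
noncomputable def capacity {X : Type} [Fintype X] {d : ℕ}
    (W : X → Matrix (Fin d) (Fin d) ℂ) : ℝ :=
  sSup { c : ℝ | ∃ P : X → ℝ, IsProbDist P ∧ c = mutualInfo P W }

/-- Conditional information variance `V(P, W)`. -/
noncomputable def infoVar {X : Type} [Fintype X] {d : ℕ}
    (P : X → ℝ) (W : X → Matrix (Fin d) (Fin d) ℂ) : ℝ :=
  ∑ x, P x * qV (W x) (avgState P W)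

/-- The variant conditional information variance `Ṽ(P, W)`. -/
noncomputable def infoVarTilde {X : Type} [Fintype X] {d : ℕ}
    (P : X → ℝ) (W : X → Matrix (Fin d) (Fin d) ℂ) : ℝ :=
  ∑ x, P x * qVtilde (W x) (avgState P W)

/-- Minimal peripheral information variance `V_W`. -/
noncomputable def Vmin {X : Type} [Fintype X] {d : ℕ}
    (W : X → Matrix (Fin d) (Fin d) ℂ) : ℝ :=
  sInf { v : ℝ | ∃ P : X → ℝ, IsProbDist P ∧ mutualInfo P W = capacity W ∧ v = infoVar P W }

/-- Minimal variant peripheral information variance `Ṽ_W`. -/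
noncomputable def VminTilde {X : Type} [Fintype X] {d : ℕ}
    (W : X → Matrix (Fin d) (Fin d) ℂ) : ℝ :=
  sInf { v : ℝ | ∃ P : X → ℝ, IsProbDist P ∧ mutualInfo P W = capacity W ∧ v = infoVarTilde P W }

/-- Conditional relative entropy `D(W‖σ|P)`. -/
noncomputable def Dcond {X : Type} [Fintype X] {d : ℕ}
    (W : X → Matrix (Fin d) (Fin d) ℂ) (σ : Matrix (Fin d) (Fin d) ℂ) (P : X → ℝ) : ℝ :=
  ∑ x, P x * qD (W x) σ

/-- Conditional relative entropy variance `V(W‖σ|P)`. -/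
noncomputable def Vcond {X : Type} [Fintype X] {d : ℕ}
    (W : X → Matrix (Fin d) (Fin d) ℂ) (σ : Matrix (Fin d) (Fin d) ℂ) (P : X → ℝ) : ℝ :=
  ∑ x, P x * qV (W x) σ

/-- Conditional order-zero Rényi divergence `D₀(W‖σ|P)`. -/
noncomputable def D0cond {X : Type} [Fintype X] {d : ℕ}
    (W : X → Matrix (Fin d) (Fin d) ℂ) (σ : Matrix (Fin d) (Fin d) ℂ) (P : X → ℝ) : ℝ :=
  ∑ x, P x * qD0 (W x) σ

/-- The exponent function `E_h(s, P, σ)`. -/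
noncomputable def Eh {X : Type} [Fintype X] {d : ℕ}
    (W : X → Matrix (Fin d) (Fin d) ℂ) (s : ℝ) (P : X → ℝ)
    (σ : Matrix (Fin d) (Fin d) ℂ) : ℝ :=
  -(1 + s) * ∑ x, P x * Real.log (reTr (mpow (W x) (1 / (1 + s)) * mpow σ (s / (1 + s))))

/-- The log-Euclidean exponent function `Ẽ_h(s, P, σ)`. -/
noncomputable def EhTilde {X : Type} [Fintype X] {d : ℕ}
    (W : X → Matrix (Fin d) (Fin d) ℂ) (s : ℝ) (P : X → ℝ)
    (σ : Matrix (Fin d) (Fin d) ℂ) : ℝ :=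
  -(1 + s) * ∑ x, P x *
    Real.log (reTr (mexp ((((1 + s)⁻¹ : ℝ) : ℂ) • (mlog (W x) + ((s : ℝ) : ℂ) • mlog σ))))

/-- The modified auxiliary function `Ẽ₀(s, P, σ)`. -/
noncomputable def E0Tilde {X : Type} [Fintype X] {d : ℕ}
    (W : X → Matrix (Fin d) (Fin d) ℂ) (s : ℝ) (P : X → ℝ)
    (σ : Matrix (Fin d) (Fin d) ℂ) : ℝ :=
  - Real.log (∑ x, P x * reTr (mpow (W x) (1 - s) * mpow σ s))

/-- The sphere-packing exponent `E_sp^{(2)}(R, P, σ)`. -/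
noncomputable def Esp2 {X : Type} [Fintype X] {d : ℕ}
    (W : X → Matrix (Fin d) (Fin d) ℂ) (R : ℝ) (P : X → ℝ)
    (σ : Matrix (Fin d) (Fin d) ℂ) : ℝ :=
  sSup { e : ℝ | ∃ s : ℝ, 0 ≤ s ∧ e = Eh W s P σ - s * R }

/-- The sphere-packing exponent `Ẽ_sp(R, P, σ)`. -/
noncomputable def EspTilde {X : Type} [Fintype X] {d : ℕ}
    (W : X → Matrix (Fin d) (Fin d) ℂ) (R : ℝ) (P : X → ℝ)
    (σ : Matrix (Fin d) (Fin d) ℂ) : ℝ :=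
  sSup { e : ℝ | ∃ s : ℝ, 0 ≤ s ∧ e = EhTilde W s P σ - s * R }

open Classical in
/-- Empirical distribution of a word `x^n ∈ X^n`. -/
noncomputable def empDist {X : Type} [Fintype X] {n : ℕ} (xs : Fin n → X) (x : X) : ℝ :=
  ((Finset.univ.filter fun i => xs i = x).card : ℝ) / n

/-- Smallest average error probability `ε*(n, R)` over all `n`-blocklength codes with
`⌈exp (n R)⌉` messages. -/
noncomputable def optErr {X : Type} [Fintype X] {d : ℕ}
    (W : X → Matrix (Fin d) (Fin d) ℂ) (n : ℕ) (R : ℝ) : ℝ :=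
  sInf { e : ℝ | ∃ (f : Fin ⌈Real.exp (n * R)⌉₊ → Fin n → X)
    (Pov : Fin ⌈Real.exp (n * R)⌉₊ → Matrix (Fin n → Fin d) (Fin n → Fin d) ℂ),
    (∀ m, (Pov m).PosSemidef) ∧ (∑ m, Pov m) = 1 ∧
    e = (1 / (⌈Real.exp (n * R)⌉₊ : ℝ)) *
      ∑ m, (1 - reTr (Pov m * tensorSeq (fun k => W (f m k)))) }

/-- The binary entropy function. -/
noncomputable def binEnt (p : ℝ) : ℝ :=
  -p * Real.log p - (1 - p) * Real.log (1 - p)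

section BanachAlgebra

variable {𝔸 : Type*} [NormedRing 𝔸] [NormedAlgebra ℝ 𝔸] [CompleteSpace 𝔸]

open NormedSpace (exp)

theorem hasDerivAt_exp_one_sub_smul_mul_exp_smul (X Y : 𝔸) (t : ℝ) :
    HasDerivAt (fun t : ℝ => exp ((1 - t) • X) * exp (t • Y))
      (exp ((1 - t) • X) * (Y - X) * exp (t • Y)) t := by
  have h₁ : HasDerivAt (fun t : ℝ => exp ((1 - t) • X)) (-(exp ((1 - t) • X) * X)) t := by
    simpa [Function.comp_def] using
      (hasDerivAt_exp_smul_const X (1 - t)).scomp t ((hasDerivAt_id' t).const_sub 1)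
  refine (h₁.mul (hasDerivAt_exp_smul_const' Y t)).congr_deriv ?_
  simp only [mul_sub, sub_mul, neg_mul, mul_assoc]
  abel

theorem continuous_exp_one_sub_smul_mul_mul_exp_smul (X K : 𝔸) {Y : ℝ → 𝔸} (hY : Continuous Y) :
    Continuous fun p : ℝ × ℝ => exp ((1 - p.2) • X) * K * exp (p.2 • Y p.1) := by
  have hexp : Continuous (exp : 𝔸 → 𝔸) :=
    letI := NormedAlgebra.restrictScalars ℚ ℝ 𝔸
    NormedSpace.exp_continuous
  fun_prop

/-- Duhamel's formula. -/
theorem exp_sub_exp_eq_integral (X Y : 𝔸) :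
    exp Y - exp X = ∫ t in (0 : ℝ)..1, exp ((1 - t) • X) * (Y - X) * exp (t • Y) := by
  rw [intervalIntegral.integral_eq_sub_of_hasDerivAt
    (fun t _ => hasDerivAt_exp_one_sub_smul_mul_exp_smul X Y t)]
  · simp
  · exact ((continuous_exp_one_sub_smul_mul_mul_exp_smul X (Y - X)
      (continuous_const (y := Y))).comp (Continuous.prodMk_right 0)).intervalIntegrable _ _

theorem hasDerivAt_exp_add_smul (L K : 𝔸) (u : ℝ) :
    HasDerivAt (fun u : ℝ => exp (L + u • K))
      (∫ t in (0 : ℝ)..1, exp ((1 - t) • (L + u • K)) * K * exp (t • (L + u • K))) u := by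
  have hG : Continuous fun v : ℝ =>
      ∫ t in (0 : ℝ)..1, exp ((1 - t) • (L + u • K)) * K * exp (t • (L + v • K)) :=
    intervalIntegral.continuous_parametric_intervalIntegral_of_continuous'
      (continuous_exp_one_sub_smul_mul_mul_exp_smul (L + u • K) K
        (Y := fun v => L + v • K) (by fun_prop)) 0 1
  rw [hasDerivAt_iff_tendsto_slope]
  refine (hG.continuousAt.tendsto.mono_left nhdsWithin_le_nhds).congr' ?_
  filter_upwards [self_mem_nhdsWithin] with v hv
  have hvu : v - u ≠ 0 := sub_ne_zero.mpr hv
  have hsub : L + v • K - (L + u • K) = (v - u) • K := by module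
  rw [slope_def_module, exp_sub_exp_eq_integral, hsub]
  simp only [mul_smul_comm, smul_mul_assoc, intervalIntegral.integral_smul, smul_smul,
    inv_mul_cancel₀ hvu, one_smul]

theorem continuous_duhamel_integrand (X K : 𝔸) :
    Continuous fun t : ℝ => exp ((1 - t) • X) * K * exp (t • X) :=
  (continuous_exp_one_sub_smul_mul_mul_exp_smul X K
    (continuous_const (y := X))).comp (Continuous.prodMk_right 0)

end BanachAlgebra

section FunctionalCalculus

open NormedSpace (exp)

variable {d : ℕ} {A : Matrix (Fin d) (Fin d) ℂ}

theorem matFun_eq_cfc (hA : A.IsHermitian) (f : ℝ → ℝ) : matFun f A = cfc f A := by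
  rw [matFun, dif_pos hA, hA.cfc_eq]

theorem isHermitian_matFun (hA : A.IsHermitian) (f : ℝ → ℝ) : (matFun f A).IsHermitian := by
  rw [matFun_eq_cfc hA]
  exact cfc_predicate f A

theorem matFun_id (hA : A.IsHermitian) : matFun (fun x => x) A = A := by
  rw [matFun_eq_cfc hA, cfc_id' ℝ A hA.isSelfAdjoint]

theorem smul_matFun (hA : A.IsHermitian) (t : ℝ) (f : ℝ → ℝ) :
    t • matFun f A = matFun (fun x => t * f x) A := by
  rw [matFun_eq_cfc hA, matFun_eq_cfc hA, ← cfc_smul t f A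
    (Matrix.finite_real_spectrum.continuousOn f)]
  rfl

theorem exp_matFun (hA : A.IsHermitian) (f : ℝ → ℝ) :
    exp (matFun f A) = matFun (fun x => Real.exp (f x)) A := by
  have h := Matrix.exp_units_conj (Unitary.toUnits hA.eigenvectorUnitary)
    (Matrix.diagonal (RCLike.ofReal ∘ f ∘ hA.eigenvalues : Fin d → ℂ))
  rw [Matrix.exp_diagonal] at h
  rw [matFun, matFun, dif_pos hA, dif_pos hA, Matrix.IsHermitian.cfc, Matrix.IsHermitian.cfc]
  refine h.trans ?_
  congr 3
  ext i
  simp [Pi.coe_exp, ← Complex.exp_eq_exp_ℂ]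

theorem mexp_eq_exp (hA : A.IsHermitian) : mexp A = exp A := by
  conv_rhs => rw [← matFun_id hA]
  rw [exp_matFun hA, mexp]

theorem isHermitian_mlog (hA : A.IsHermitian) : (mlog A).IsHermitian :=
  isHermitian_matFun hA Real.log

theorem exp_smul_mlog (hA : A.PosDef) (t : ℝ) : exp (t • mlog A) = mpow A t := by
  rw [mlog, smul_matFun hA.isHermitian, exp_matFun hA.isHermitian, mpow,
    matFun_eq_cfc hA.isHermitian, matFun_eq_cfc hA.isHermitian]
  refine cfc_congr fun x hx => ?_
  rw [hA.isHermitian.spectrum_real_eq_range_eigenvalues] at hx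
  obtain ⟨i, rfl⟩ := hx
  have hpos := hA.eigenvalues_pos i
  simp only [hpos.ne', if_false, Real.rpow_def_of_pos hpos, mul_comm]

theorem exp_mlog (hA : A.PosDef) : exp (mlog A) = A := by
  rw [← one_smul ℝ (mlog A), exp_smul_mlog hA, mpow]
  conv_rhs => rw [← matFun_id hA.isHermitian]
  congr 1
  ext x
  by_cases hx : x = 0 <;> simp [hx]

theorem reTr_exp_pos [NeZero d] (hA : A.IsHermitian) :
    0 < reTr (exp A) := by
  have hA2 : ((2⁻¹ : ℝ) • A).IsHermitian := hA.smul (IsSelfAdjoint.all _)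
  have h : exp A = (exp ((2⁻¹ : ℝ) • A)).conjTranspose * exp ((2⁻¹ : ℝ) • A) := by
    rw [hA2.exp.eq, ← Matrix.exp_add_of_commute _ _ (Commute.refl _), ← add_smul]
    norm_num
  have hpd : (exp A).PosDef := by
    rw [h]
    exact Matrix.PosDef.conjTranspose_mul_self _
      (Matrix.mulVec_injective_of_isUnit (Matrix.isUnit_exp _))
  exact (Complex.pos_iff.mp hpd.trace_pos).1

end FunctionalCalculus

section Matrix

open NormedSpace (exp)
open scoped Matrix.Norms.Operator

variable {d : ℕ}

/-- The real trace of a product, as a continuous linear functional of the left factor. -/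
def reTrMulRight (K : Matrix (Fin d) (Fin d) ℂ) : Matrix (Fin d) (Fin d) ℂ →L[ℝ] ℝ where
  toFun A := reTr (A * K)
  map_add' A B := by simp [reTr, add_mul]
  map_smul' c A := by simp [reTr]
  cont := by unfold reTr; fun_prop

theorem hasDerivAt_reTr_exp_mul (L K M : Matrix (Fin d) (Fin d) ℂ) (u : ℝ) :
    HasDerivAt (fun u : ℝ => reTr (exp (L + u • K) * M))
      (∫ t in (0 : ℝ)..1,
        reTr (exp ((1 - t) • (L + u • K)) * K * exp (t • (L + u • K)) * M)) u := by
  have h := (reTrMulRight M).hasFDerivAt.comp_hasDerivAt u (hasDerivAt_exp_add_smul L K u)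
  rw [← (reTrMulRight M).intervalIntegral_comp_comm
    ((continuous_duhamel_integrand _ _).intervalIntegrable _ _)] at h
  exact h

theorem hasDerivAt_reTr_exp (L K : Matrix (Fin d) (Fin d) ℂ) (u : ℝ) :
    HasDerivAt (fun u : ℝ => reTr (exp (L + u • K))) (reTr (exp (L + u • K) * K)) u := by
  have h := hasDerivAt_reTr_exp_mul L K 1 u
  simp only [mul_one] at h
  convert h using 1
  have : ∀ t : ℝ, reTr (exp ((1 - t) • (L + u • K)) * K * exp (t • (L + u • K)))
      = reTr (exp (L + u • K) * K) := fun t => by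
    have hc : Commute (t • (L + u • K)) ((1 - t) • (L + u • K)) :=
      ((Commute.refl _).smul_left t).smul_right (1 - t)
    rw [reTr, Matrix.trace_mul_comm, ← mul_assoc, ← Matrix.exp_add_of_commute _ _ hc,
      ← add_smul, add_sub_cancel, one_smul, reTr]
  simp only [this, intervalIntegral.integral_const, sub_zero, one_smul]

end Matrix

section LogExponent

variable {f g : ℝ → ℝ} {s : ℝ}

theorem hasDerivAt_comp_inv_one_add {f' : ℝ} (hf : HasDerivAt f f' (1 + s)⁻¹) (hs : 1 + s ≠ 0) :
    HasDerivAt (fun s => f (1 + s)⁻¹) (f' * (-1 / (1 + s) ^ 2)) s :=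
  hf.comp s (((hasDerivAt_id' s).const_add 1).fun_inv hs)

theorem hasDerivAt_neg_one_add_mul_log (hf : HasDerivAt f (g (1 + s)⁻¹) (1 + s)⁻¹)
    (hs : 1 + s ≠ 0) (hpos : f (1 + s)⁻¹ ≠ 0) :
    HasDerivAt (fun s => -(1 + s) * Real.log (f (1 + s)⁻¹))
      (-Real.log (f (1 + s)⁻¹) + (1 + s)⁻¹ * g (1 + s)⁻¹ / f (1 + s)⁻¹) s := by
  refine ((((hasDerivAt_id' s).const_add 1).fun_neg).fun_mul
    ((hasDerivAt_comp_inv_one_add hf hs).log hpos)).congr_deriv ?_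
  field_simp

theorem hasDerivAt_neg_log_add {g' : ℝ} (hf : HasDerivAt f (g 1) 1) (hg : HasDerivAt g g' 1)
    (h1 : f 1 = 1) :
    HasDerivAt (fun s => -Real.log (f (1 + s)⁻¹) + (1 + s)⁻¹ * g (1 + s)⁻¹ / f (1 + s)⁻¹)
      (-(g' - g 1 ^ 2)) 0 := by
  have h0 : (1 + (0 : ℝ))⁻¹ = 1 := by norm_num
  have hs : 1 + (0 : ℝ) ≠ 0 := by norm_num
  have hne : f (1 + 0)⁻¹ ≠ 0 := by simp [h1]
  have hφ := hasDerivAt_comp_inv_one_add (s := 0) (h0.symm ▸ hf) hs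
  have hψ := hasDerivAt_comp_inv_one_add (s := 0) (h0.symm ▸ hg) hs
  have hinv := ((hasDerivAt_id' (0 : ℝ)).const_add 1).fun_inv hs
  refine ((hφ.log hne).fun_neg.fun_add ((hinv.fun_mul hψ).fun_div hφ hne)).congr_deriv ?_
  simp [h1]
  ring

end LogExponent

section Exponent

open NormedSpace (exp)

variable {d : ℕ}

theorem EhTilde_eq_sum {X : Type} [Fintype X] {W : X → Matrix (Fin d) (Fin d) ℂ}
    (hW : ∀ x, (W x).IsHermitian) {σ : Matrix (Fin d) (Fin d) ℂ} (hσ : σ.IsHermitian)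
    (P : X → ℝ) {s : ℝ} (hs : 1 + s ≠ 0) :
    EhTilde W s P σ = ∑ x, P x * (-(1 + s) *
      Real.log (reTr (exp (mlog σ + (1 + s)⁻¹ • (mlog (W x) - mlog σ))))) := by
  rw [EhTilde, Finset.mul_sum]
  refine Finset.sum_congr rfl fun x _ => ?_
  have h : (((1 + s)⁻¹ : ℝ) : ℂ) • (mlog (W x) + ((s : ℝ) : ℂ) • mlog σ)
      = mlog σ + (1 + s)⁻¹ • (mlog (W x) - mlog σ) := by
    simp only [Complex.coe_smul]
    have : mlog σ = ((1 + s)⁻¹ * (1 + s)) • mlog σ := by rw [inv_mul_cancel₀ hs, one_smul]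
    nth_rw 2 [this]
    module
  have hH : (mlog σ + (1 + s)⁻¹ • (mlog (W x) - mlog σ)).IsHermitian :=
    (isHermitian_mlog hσ).add
      (((isHermitian_mlog (hW x)).sub (isHermitian_mlog hσ)).smul (IsSelfAdjoint.all _))
  rw [h, mexp_eq_exp hH]
  ring

theorem integral_reTr_exp_sub_sq_eq_qVtilde {ρ : Matrix (Fin d) (Fin d) ℂ} (hρ : ρ.PosDef)
    (σ : Matrix (Fin d) (Fin d) ℂ) :
    (∫ t in (0 : ℝ)..1, reTr (exp ((1 - t) • mlog ρ) * (mlog ρ - mlog σ) * exp (t • mlog ρ) *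
      (mlog ρ - mlog σ))) - reTr (exp (mlog ρ) * (mlog ρ - mlog σ)) ^ 2 = qVtilde ρ σ := by
  simp only [exp_smul_mlog hρ, exp_mlog hρ, qVtilde, qD]

end Exponent

/-- **Second (right) derivative of the log-Euclidean exponent function `Ẽ_h` at `s = 0`.** -/
theorem EhTilde_second_derivWithin_zero
    {X : Type} [Fintype X] {d : ℕ}
    (W : X → Matrix (Fin d) (Fin d) ℂ) (hW : ∀ x, (W x).PosDef ∧ (W x).trace = 1)
    (σ : Matrix (Fin d) (Fin d) ℂ) (hσ : σ.PosDef ∧ σ.trace = 1)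
    (P : X → ℝ) (hP : IsProbDist P) :
    HasDerivWithinAt (derivWithin (fun s => EhTilde W s P σ) (Set.Ici 0))
      (-(∑ x, P x * qVtilde (W x) σ)) (Set.Ici 0) 0 := by
  have : NeZero d := ⟨by rintro rfl; simpa using hσ.2⟩
  set K : X → Matrix (Fin d) (Fin d) ℂ := fun x => mlog (W x) - mlog σ with hK
  set f : X → ℝ → ℝ := fun x u => reTr (NormedSpace.exp (mlog σ + u • K x)) with hf
  set g : X → ℝ → ℝ := fun x u => reTr (NormedSpace.exp (mlog σ + u • K x) * K x) with hg
  have hWH (x) : (W x).IsHermitian := (hW x).1.isHermitian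
  have hσH : σ.IsHermitian := hσ.1.isHermitian
  have hne (x : X) (u : ℝ) : f x u ≠ 0 :=
    (reTr_exp_pos ((isHermitian_mlog hσH).add
      (((isHermitian_mlog (hWH x)).sub (isHermitian_mlog hσH)).smul (IsSelfAdjoint.all u)))).ne'
  have hfg (x : X) (u : ℝ) : HasDerivAt (f x) (g x u) u := hasDerivAt_reTr_exp _ _ u
  have hone (x : X) : mlog σ + (1 : ℝ) • K x = mlog (W x) := by simp [hK]
  have hf1 (x : X) : f x 1 = 1 := by
    simp only [hf, hone, exp_mlog (hW x).1, reTr, (hW x).2, Complex.one_re]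
  have hfirst : ∀ s ∈ Set.Ici (0 : ℝ), derivWithin (fun s => EhTilde W s P σ) (Set.Ici 0) s =
      ∑ x, P x * (-Real.log (f x (1 + s)⁻¹) + (1 + s)⁻¹ * g x (1 + s)⁻¹ / f x (1 + s)⁻¹) := by
    intro s hs
    have hs' (r : ℝ) (hr : r ∈ Set.Ici (0 : ℝ)) : 1 + r ≠ 0 := by
      have := Set.mem_Ici.mp hr
      positivity
    have h := HasDerivAt.fun_sum (u := Finset.univ) fun x _ =>
      (hasDerivAt_neg_one_add_mul_log (hfg x _) (hs' s hs) (hne x _)).const_mul (P x)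
    exact (h.hasDerivWithinAt.congr_of_mem
      (fun r hr => EhTilde_eq_sum hWH hσH P (hs' r hr)) hs).derivWithin (uniqueDiffOn_Ici 0 s hs)
  refine HasDerivWithinAt.congr_of_mem (HasDerivAt.hasDerivWithinAt ?_) hfirst Set.self_mem_Ici
  refine (HasDerivAt.fun_sum (u := Finset.univ) fun x _ => (hasDerivAt_neg_log_add (hfg x 1)
    (hasDerivAt_reTr_exp_mul (mlog σ) (K x) (K x) 1) (hf1 x)).const_mul (P x)).congr_deriv ?_
  simp only [hg, hone, mul_neg, Finset.sum_neg_distrib]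
  simp only [hK, integral_reTr_exp_sub_sq_eq_qVtilde (hW _).1]

end MDQ
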